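/- Let q be an odd prime power, d ≥ 2, let Q be a non-degenerate quadratic form on F_q^d, let E ⊆ F_q^d, let k ≥ 3 be an odd integer, and let t ∈ F_q∖{0}. Set S_t = {x ∈ F_q^d : Q(x) = t}. Then |ν_k(t) − |S_t|·|E|^k/q^d| ≤ 2·q^{(d−1)/2}·(Λ_{k−1}(E))^{1/2}·(Λ_{k+1}(E))^{1/2}. -/

import Mathlib

open Finset

/-- The `k`-energy `Λ_k(E)` of a set `E` (intended for even `k = 2m`): the number of
`k`-tuples from `E` whose first `k/2` entries and last `k/2` entries have equal sums. -/
noncomputable def energy {G : Type} [AddCommMonoid G] (E : Finset G) (k : ℕ) : ℕ :=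
  Nat.card {x : Fin k → G // (∀ i, x i ∈ E) ∧
    (∑ i ∈ Finset.univ.filter (fun i : Fin k => (i : ℕ) < k / 2), x i) =
    (∑ i ∈ Finset.univ.filter (fun i : Fin k => ¬ (i : ℕ) < k / 2), x i)}

/-- `ν_k(t)`: the number of `k`-tuples from `E` whose sum lies on the level set `Q = t`. -/
noncomputable def nuQ {F : Type} [Field F] [Fintype F] {d : ℕ}
    (Q : QuadraticForm F (Fin d → F)) (E : Finset (Fin d → F)) (k : ℕ) (t : F) : ℕ :=
  Nat.card {x : Fin k → (Fin d → F) // (∀ i, x i ∈ E) ∧ Q (∑ i, x i) = t}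

section PolynomialSums

open Polynomial

variable {F : Type} [Field F] [Finite F]

theorem finite_setOf_monic_natDegree_eq (F : Type) [Field F] [Finite F] (n : ℕ) :
    {g : F[X] | g.Monic ∧ g.natDegree = n}.Finite := by
  have : Finite (degreeLT F n) := Finite.of_equiv _ (degreeLTEquiv F n).symm.toEquiv
  exact Finite.of_equiv _ (monicEquivDegreeLT n).symm

/-- The monic polynomials of degree `n` over a finite field. -/
noncomputable def monics (F : Type) [Field F] [Finite F] (n : ℕ) : Finset F[X] :=
  (finite_setOf_monic_natDegree_eq F n).toFinset

@[simp]
theorem mem_monics {n : ℕ} {g : F[X]} : g ∈ monics F n ↔ g.Monic ∧ g.natDegree = n := by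
  simp [monics]

open Classical in
/-- The monic irreducible polynomials of degree at most `n` over a finite field. -/
noncomputable def monicIrreducibles (F : Type) [Field F] [Finite F] (n : ℕ) : Finset F[X] :=
  ((range (n + 1)).biUnion (monics F)).filter Irreducible

@[simp]
theorem mem_monicIrreducibles {n : ℕ} {P : F[X]} :
    P ∈ monicIrreducibles F n ↔ P.Monic ∧ Irreducible P ∧ P.natDegree ≤ n := by
  simp only [monicIrreducibles, mem_filter, mem_biUnion, mem_range, mem_monics]
  constructor
  · rintro ⟨⟨m, hm, h1, h2⟩, h3⟩
    exact ⟨h1, h3, by omega⟩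
  · rintro ⟨h1, h2, h3⟩
    exact ⟨⟨_, by omega, h1, rfl⟩, h2⟩

open Classical in
/-- The degree of a monic polynomial, as the sum of the degrees of the prime powers dividing it. -/
theorem natDegree_eq_sum_primePowers {n : ℕ} {g : F[X]} (hg : g ∈ monics F n) :
    n = ∑ P ∈ monicIrreducibles F n, ∑ k ∈ Icc 1 n, if P ^ k ∣ g then P.natDegree else 0 := by
  obtain ⟨hm, rfl⟩ := mem_monics.1 hg
  have hg0 := hm.ne_zero
  have hprod : (UniqueFactorizationMonoid.normalizedFactors g).prod = g := by
    rw [UniqueFactorizationMonoid.prod_normalizedFactors_eq hg0, hm.normalize_eq_self]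
  have hcount : ∀ P ∈ monicIrreducibles F g.natDegree,
      (∑ k ∈ Icc 1 g.natDegree, if P ^ k ∣ g then P.natDegree else 0) =
        (UniqueFactorizationMonoid.normalizedFactors g).count P * P.natDegree := by
    intro P hP
    obtain ⟨hPm, hPi, -⟩ := mem_monicIrreducibles.1 hP
    have hmul := UniqueFactorizationMonoid.emultiplicity_eq_count_normalizedFactors hPi hg0
    rw [hPm.normalize_eq_self] at hmul
    have hdvd : ∀ k, P ^ k ∣ g ↔ k ≤ (UniqueFactorizationMonoid.normalizedFactors g).count P := by
      intro k
      rw [pow_dvd_iff_le_emultiplicity, hmul, Nat.cast_le]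
    have hle : (UniqueFactorizationMonoid.normalizedFactors g).count P ≤ g.natDegree := by
      have h1 := natDegree_le_of_dvd ((hdvd _).2 le_rfl) hg0
      rw [natDegree_pow] at h1
      exact le_trans (Nat.le_mul_of_pos_right _ hPi.natDegree_pos) h1
    rw [← sum_filter, sum_const, smul_eq_mul]
    congr 1
    have : (Icc 1 g.natDegree).filter (fun k => P ^ k ∣ g) =
        Icc 1 ((UniqueFactorizationMonoid.normalizedFactors g).count P) := by
      ext k
      simp only [mem_filter, mem_Icc, hdvd]
      omega
    rw [this, Nat.card_Icc, Nat.add_sub_cancel]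
  rw [sum_congr rfl hcount]
  have h0 : (0 : F[X]) ∉ UniqueFactorizationMonoid.normalizedFactors g :=
    UniqueFactorizationMonoid.zero_notMem_normalizedFactors g
  conv_lhs => rw [← hprod, natDegree_multiset_prod _ h0]
  rw [sum_multiset_map_count]
  refine sum_subset_zero_on_sdiff ?_ ?_ (fun _ _ => by simp)
  · intro P hP
    rw [Multiset.mem_toFinset] at hP
    have hi := UniqueFactorizationMonoid.irreducible_of_normalized_factor P hP
    refine mem_monicIrreducibles.2 ⟨?_, hi, natDegree_le_of_dvd
      (UniqueFactorizationMonoid.dvd_of_mem_normalizedFactors hP) hg0⟩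
    rw [← UniqueFactorizationMonoid.normalize_normalized_factor P hP]
    exact monic_normalize hi.ne_zero
  · intro P hP
    rw [mem_sdiff, Multiset.mem_toFinset, ← Multiset.count_eq_zero] at hP
    simp [hP.2]

/-- The sum of a function on monic polynomials over those of degree `n`. -/
noncomputable def monicSum (χ : F[X] → ℂ) (n : ℕ) : ℂ := ∑ g ∈ monics F n, χ g

/-- The sum of `deg P * χ P ^ k` over the powers `P ^ k` of degree `j` of
monic irreducible polynomials `P`. -/
noncomputable def primePowerSum (χ : F[X] → ℂ) (j : ℕ) : ℂ :=
  ∑ P ∈ monicIrreducibles F j with P.natDegree ∣ j,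
    (P.natDegree : ℂ) * χ P ^ (j / P.natDegree)

open Classical in
theorem sum_monics_of_pow_dvd {χ : F[X] → ℂ} (h1 : χ 1 = 1)
    (hmul : ∀ g h : F[X], g.Monic → h.Monic → χ (g * h) = χ g * χ h)
    {P : F[X]} (hP : P.Monic) (n k : ℕ) :
    ∑ g ∈ monics F n with P ^ k ∣ g, χ g =
      if k * P.natDegree ≤ n then χ P ^ k * monicSum χ (n - k * P.natDegree) else 0 := by
  have hpow : ∀ k, χ (P ^ k) = χ P ^ k := by
    intro k
    induction k with
    | zero => simp [h1]
    | succ k ih => rw [pow_succ, hmul _ _ (hP.pow k) hP, ih, pow_succ]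
  split_ifs with h
  · rw [monicSum, mul_sum]
    symm
    refine sum_bij (fun g _ => P ^ k * g) ?_ ?_ ?_ ?_
    · intro g hg
      obtain ⟨hm, hd⟩ := mem_monics.1 hg
      simp only [mem_filter, mem_monics]
      refine ⟨⟨(hP.pow k).mul hm, ?_⟩, dvd_mul_right _ _⟩
      rw [(hP.pow k).natDegree_mul hm, hP.natDegree_pow, hd]
      omega
    · intro g _ g' _ hgg
      exact mul_left_cancel₀ (hP.pow k).ne_zero hgg
    · intro g hg
      simp only [mem_filter, mem_monics] at hg
      obtain ⟨⟨hm, hd⟩, g', rfl⟩ := hg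
      have hm' := (hP.pow k).of_mul_monic_left hm
      refine ⟨g', mem_monics.2 ⟨hm', ?_⟩, rfl⟩
      rw [(hP.pow k).natDegree_mul hm', hP.natDegree_pow] at hd
      omega
    · intro g hg
      rw [hmul _ _ (hP.pow k) (mem_monics.1 hg).1, hpow]
  · refine sum_eq_zero fun g hg => ?_
    simp only [mem_filter, mem_monics] at hg
    obtain ⟨⟨hm, hd⟩, hdvd⟩ := hg
    have := natDegree_le_of_dvd hdvd hm.ne_zero
    rw [hP.natDegree_pow] at this
    omega

/-- The coefficient form of `T d(log L(T)) / dT = ∑ j, primePowerSum χ j * T ^ j` for the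
`L`-function `L(T) = ∑ n, monicSum χ n * T ^ n` of a multiplicative function. -/
theorem natCast_mul_monicSum {χ : F[X] → ℂ} (h1 : χ 1 = 1)
    (hmul : ∀ g h : F[X], g.Monic → h.Monic → χ (g * h) = χ g * χ h) (n : ℕ) :
    (n : ℂ) * monicSum χ n = ∑ j ∈ Icc 1 n, primePowerSum χ j * monicSum χ (n - j) := by
  classical
  have hsplit : (n : ℂ) * monicSum χ n = ∑ P ∈ monicIrreducibles F n, ∑ k ∈ Icc 1 n,
      (P.natDegree : ℂ) * ∑ g ∈ monics F n with P ^ k ∣ g, χ g := by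
    have : ∀ g ∈ monics F n, (n : ℂ) * χ g = ∑ P ∈ monicIrreducibles F n, ∑ k ∈ Icc 1 n,
        (P.natDegree : ℂ) * if P ^ k ∣ g then χ g else 0 := by
      intro g hg
      conv_lhs => rw [natDegree_eq_sum_primePowers hg]
      push_cast
      simp only [sum_mul]
      refine sum_congr rfl fun P _ => sum_congr rfl fun k _ => ?_
      split_ifs <;> simp
    rw [monicSum, mul_sum, sum_congr rfl this, sum_comm]
    refine sum_congr rfl fun P _ => ?_
    rw [sum_comm]
    refine sum_congr rfl fun k _ => ?_
    rw [← mul_sum, sum_filter]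
  rw [hsplit]
  have hR : ∀ j ∈ Icc 1 n, primePowerSum χ j * monicSum χ (n - j) =
      ∑ P ∈ monicIrreducibles F n, if P.natDegree ∣ j then
        (P.natDegree : ℂ) * χ P ^ (j / P.natDegree) * monicSum χ (n - j) else 0 := by
    intro j hj
    rw [mem_Icc] at hj
    rw [primePowerSum, sum_mul, ← sum_filter]
    refine sum_congr ?_ fun _ _ => rfl
    ext P
    simp only [mem_filter, mem_monicIrreducibles]
    constructor
    · rintro ⟨⟨h1, h2, h3⟩, h4⟩
      exact ⟨⟨h1, h2, by omega⟩, h4⟩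
    · rintro ⟨⟨h1, h2, h3⟩, h4⟩
      exact ⟨⟨h1, h2, Nat.le_of_dvd (by omega) h4⟩, h4⟩
  rw [sum_congr rfl hR]
  conv_rhs => rw [sum_comm]
  refine sum_congr rfl fun P hP => ?_
  obtain ⟨hPm, hPi, hPn⟩ := mem_monicIrreducibles.1 hP
  have hpos := hPi.natDegree_pos
  simp only [sum_monics_of_pow_dvd h1 hmul hPm, mul_ite, mul_zero]
  rw [← sum_filter, ← sum_filter]
  refine sum_bij (fun k _ => k * P.natDegree) ?_ ?_ ?_ ?_
  · intro k hk
    simp only [mem_filter, mem_Icc] at hk ⊢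
    exact ⟨⟨Nat.mul_pos (by omega) hpos, hk.2⟩, dvd_mul_left _ _⟩
  · intro k _ k' _ h
    exact Nat.eq_of_mul_eq_mul_right hpos h
  · intro j hj
    simp only [mem_filter, mem_Icc] at hj
    obtain ⟨⟨hj1, hjn⟩, k, rfl⟩ := hj
    refine ⟨k, ?_, mul_comm _ _⟩
    simp only [mem_filter, mem_Icc]
    rw [mul_comm k]
    refine ⟨⟨Nat.pos_of_ne_zero ?_, ?_⟩, hjn⟩
    · rintro rfl
      simp at hj1
    · exact le_trans (Nat.le_mul_of_pos_left _ hpos) hjn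
  · intro k _
    rw [Nat.mul_div_cancel _ hpos, mul_assoc]

end PolynomialSums

section KloostermanLFunction

open Polynomial

variable {F : Type} [Field F]

/-- The multiplicative function on monic polynomials whose value at `g` with `g(0) ≠ 0` is
`ψ (∑ x, (x + a / x))`, where `x` runs over the roots of `g`. -/
noncomputable def kloostermanChar (ψ : AddChar F ℂ) (a : F) (g : F[X]) : ℂ :=
  open Classical in
  if g.coeff 0 = 0 then 0 else ψ (-g.nextCoeff - a * (g.coeff 1 / g.coeff 0))

theorem kloostermanChar_one (ψ : AddChar F ℂ) (a : F) : kloostermanChar ψ a 1 = 1 := by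
  simp [kloostermanChar, coeff_one, nextCoeff]

theorem kloostermanChar_mul (ψ : AddChar F ℂ) (a : F) (g h : F[X]) (hg : g.Monic)
    (hh : h.Monic) :
    kloostermanChar ψ a (g * h) = kloostermanChar ψ a g * kloostermanChar ψ a h := by
  unfold kloostermanChar
  rw [mul_coeff_zero]
  by_cases h1 : g.coeff 0 = 0
  · simp [h1]
  by_cases h2 : h.coeff 0 = 0
  · simp [h2]
  rw [if_neg h1, if_neg h2, if_neg (mul_ne_zero h1 h2), hg.nextCoeff_mul hh, mul_coeff_one,
    ← AddChar.map_add_eq_mul]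
  congr 1
  field_simp
  ring

/-- The Kloosterman sum `∑ ψ (Tr (x + a / x))` over the nonzero elements of an extension field. -/
noncomputable def kloostermanSum (L : Type) [Field L] [Fintype L] [Algebra F L]
    (ψ : AddChar F ℂ) (a : F) : ℂ :=
  open Classical in
  ∑ x : L, if x = 0 then 0 else ψ (Algebra.trace F L (x + algebraMap F L a * x⁻¹))

section trace

variable {L : Type} [Field L] [Algebra F L] [FiniteDimensional F L]

open IntermediateField in
theorem nextCoeff_minpoly_inv {x : L} (hx : x ≠ 0) :
    (minpoly F x⁻¹).nextCoeff = (minpoly F x).coeff 1 / (minpoly F x).coeff 0 := by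
  have hxi : IsIntegral F x := .of_finite F x
  have hxi' : IsIntegral F x⁻¹ := .of_finite F _
  set P := minpoly F x with hP
  have h0 : P.coeff 0 ≠ 0 := minpoly.coeff_zero_ne_zero hxi hx
  have hpos : 0 < P.natDegree := minpoly.natDegree_pos hxi
  have hadj : F⟮x⁻¹⟯ = F⟮x⟯ := by
    apply le_antisymm
    · rw [adjoin_simple_le_iff]
      exact inv_mem (mem_adjoin_simple_self F x)
    · rw [adjoin_simple_le_iff]
      simpa using inv_mem (mem_adjoin_simple_self F x⁻¹)
  have hdeg : (minpoly F x⁻¹).natDegree = P.natDegree := by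
    rw [← adjoin.finrank hxi', hadj, adjoin.finrank hxi]
  have hnd : P.reverse.natDegree = P.natDegree := by
    rw [reverse_natDegree, natTrailingDegree_eq_zero.2 (Or.inr h0), Nat.sub_zero]
  set R := C (P.coeff 0)⁻¹ * P.reverse with hR
  have hRd : R.natDegree = P.natDegree := by
    rw [hR, natDegree_C_mul (inv_ne_zero h0), hnd]
  have hcoeff : ∀ i ≤ P.natDegree, R.coeff i = (P.coeff 0)⁻¹ * P.coeff (P.natDegree - i) := by
    intro i hi
    rw [hR, coeff_C_mul, coeff_reverse, revAt_le hi]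
  have hRm : R.Monic := by
    rw [Monic, leadingCoeff, hRd, hcoeff _ le_rfl, Nat.sub_self, inv_mul_cancel₀ h0]
  have hroot : aeval x⁻¹ R = 0 := by
    have : eval₂ (algebraMap F L) x⁻¹ P.reverse = 0 := by
      let : Invertible x := invertibleOfNonzero hx
      have := eval₂_reverse_eq_zero_iff (algebraMap F L) x P
      rw [invOf_eq_inv] at this
      rw [this]
      exact minpoly.aeval F x
    rw [hR, map_mul, aeval_def (p := P.reverse), this, mul_zero]
  have hmin : minpoly F x⁻¹ = R := by
    refine (minpoly.unique' F x⁻¹ hRm hroot ?_).symm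
    intro q hq
    by_contra! hcon
    obtain ⟨h1, h2⟩ : aeval x⁻¹ q = 0 ∧ q ≠ 0 := by tauto
    have := minpoly.degree_le_of_ne_zero F x⁻¹ h2 h1
    rw [degree_eq_natDegree hRm.ne_zero, hRd, ← hdeg, ← degree_eq_natDegree
      (minpoly.ne_zero hxi')] at hq
    exact absurd hq (not_lt.2 this)
  rw [hmin, nextCoeff_of_natDegree_pos (by rw [hRd]; exact hpos), hRd, hcoeff _ (by omega)]
  rw [show P.natDegree - (P.natDegree - 1) = 1 by omega]
  field_simp

open IntermediateField in
theorem trace_add_mul_inv {x : L} (hx : x ≠ 0) (a : F) :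
    Algebra.trace F L (x + algebraMap F L a * x⁻¹) =
      (Module.finrank F L / (minpoly F x).natDegree : ℕ) •
        (-(minpoly F x).nextCoeff - a * ((minpoly F x).coeff 1 / (minpoly F x).coeff 0)) := by
  have hxi : IsIntegral F x := .of_finite F x
  have hadj : F⟮x⁻¹⟯ = F⟮x⟯ := by
    apply le_antisymm
    · rw [adjoin_simple_le_iff]
      exact inv_mem (mem_adjoin_simple_self F x)
    · rw [adjoin_simple_le_iff]
      simpa using inv_mem (mem_adjoin_simple_self F x⁻¹)
  have hfin : Module.finrank F L / (minpoly F x).natDegree = Module.finrank F⟮x⟯ L := by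
    rw [← Module.finrank_mul_finrank F F⟮x⟯ L, adjoin.finrank hxi,
      Nat.mul_div_cancel_left _ (minpoly.natDegree_pos hxi)]
  rw [hfin, map_add, ← Algebra.smul_def, map_smul, trace_eq_finrank_mul_minpoly_nextCoeff F x,
    trace_eq_finrank_mul_minpoly_nextCoeff F x⁻¹, hadj, nextCoeff_minpoly_inv hx, nsmul_eq_mul,
    smul_eq_mul]
  ring

end trace

variable [Finite F]

theorem card_filter_minpoly_eq {L : Type} [Field L] [Fintype L] [Algebra F L] [DecidableEq F[X]]
    {P : F[X]} (hm : P.Monic) (hi : Irreducible P) (hd : P.natDegree ∣ Module.finrank F L) :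
    #{x : L | minpoly F x = P} = P.natDegree := by
  classical
  have hcard : Nat.card F ^ Module.finrank F L = Fintype.card L := by
    rw [← Nat.card_eq_fintype_card, Module.natCard_eq_pow_finrank (K := F) (V := L)]
  have hdvd := (hi.natDegree_dvd_iff_dvd_X_pow_card_pow_sub_X).1 hd
  rw [hcard] at hdvd
  have hne : (X ^ Fintype.card L - X : L[X]) ≠ 0 :=
    FiniteField.X_pow_card_sub_X_ne_zero L Fintype.one_lt_card
  have hdvd' : P.map (algebraMap F L) ∣ X ^ Fintype.card L - X := by
    simpa using Polynomial.map_dvd (algebraMap F L) hdvd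
  have hs : (P.map (algebraMap F L)).Splits := by
    refine Splits.of_dvd ?_ hne hdvd'
    have := (FiniteField.isSplittingField_sub L F).splits
    simpa using this
  have hnodup : (P.aroots L).Nodup := by
    refine Multiset.nodup_of_le (roots.le_of_dvd hne hdvd') ?_
    rw [FiniteField.roots_X_pow_card_sub_X]
    exact univ.nodup
  have : ({x : L | minpoly F x = P} : Finset L) = (P.aroots L).toFinset := by
    ext x
    simp only [mem_filter, mem_univ, true_and, Multiset.mem_toFinset,
      mem_aroots, hm.ne_zero, ne_eq, not_false_eq_true]
    constructor
    · rintro rfl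
      exact minpoly.aeval F x
    · intro h
      exact (minpoly.eq_of_irreducible_of_monic hi h hm).symm
  rw [this, Multiset.toFinset_card_of_nodup hnodup, ← hs.natDegree_eq_card_roots, natDegree_map]

theorem primePowerSum_kloostermanChar (L : Type) [Field L] [Fintype L] [Algebra F L]
    (ψ : AddChar F ℂ) (a : F) :
    primePowerSum (kloostermanChar ψ a) (Module.finrank F L) = kloostermanSum L ψ a := by
  classical
  have hn : 0 < Module.finrank F L := Module.finrank_pos
  have key : ∀ x : L, (if x = 0 then 0 else
      ψ (Algebra.trace F L (x + algebraMap F L a * x⁻¹))) =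
        kloostermanChar ψ a (minpoly F x) ^ (Module.finrank F L / (minpoly F x).natDegree) := by
    intro x
    split_ifs with hx
    · subst hx
      simp [kloostermanChar, hn.ne']
    · rw [trace_add_mul_inv hx, AddChar.map_nsmul_eq_pow, kloostermanChar,
        if_neg (minpoly.coeff_zero_ne_zero (.of_finite F x) hx)]
  rw [kloostermanSum, sum_congr rfl fun x _ => key x, primePowerSum]
  rw [← sum_fiberwise_of_maps_to (s := univ) (g := fun x : L => minpoly F x)
    (t := (monicIrreducibles F (Module.finrank F L)).filter
      fun P => P.natDegree ∣ Module.finrank F L)]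
  · refine sum_congr rfl fun P hP => ?_
    simp only [mem_filter, mem_monicIrreducibles] at hP
    rw [sum_congr rfl (g := fun _ => kloostermanChar ψ a P ^ (Module.finrank F L / P.natDegree)),
      sum_const, card_filter_minpoly_eq hP.1.1 hP.1.2.1 hP.2, nsmul_eq_mul]
    intro x hx
    rw [(mem_filter.1 hx).2]
  · intro x _
    have hxi : IsIntegral F x := .of_finite F x
    simp only [mem_filter, mem_monicIrreducibles]
    exact ⟨⟨minpoly.monic hxi, minpoly.irreducible hxi,
      Nat.le_of_dvd hn (minpoly.degree_dvd hxi)⟩, minpoly.degree_dvd hxi⟩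

theorem monicSum_kloostermanChar_zero (ψ : AddChar F ℂ) (a : F) :
    monicSum (kloostermanChar ψ a) 0 = 1 := by
  have : monics F 0 = {1} := by
    ext g
    simp only [mem_monics, mem_singleton]
    constructor
    · rintro ⟨h1, h2⟩
      exact h1.natDegree_eq_zero.1 h2
    · rintro rfl
      simp
  rw [monicSum, this, sum_singleton, kloostermanChar_one]

theorem monicSum_kloostermanChar_two [Fintype F] {ψ : AddChar F ℂ} (hψ : ψ.IsPrimitive) {a : F}
    (ha : a ≠ 0) : monicSum (kloostermanChar ψ a) 2 = Fintype.card F := by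
  classical
  have hsum : monicSum (kloostermanChar ψ a) 2 =
      ∑ z : F × F, kloostermanChar ψ a (X ^ 2 + C z.2 * X + C z.1) := by
    symm
    refine sum_bij (fun z _ => X ^ 2 + C z.2 * X + C z.1) ?_ ?_ ?_ (fun _ _ => rfl)
    · intro z _
      rw [mem_monics]
      constructor
      · monicity!
      · compute_degree!
    · rintro ⟨u, v⟩ _ ⟨u', v'⟩ _ h
      have h0 := congrArg (fun p => coeff p 0) h
      have h1 := congrArg (fun p => coeff p 1) h
      simp [coeff_X, coeff_C] at h0 h1
      simp [h0, h1]
    · intro g hg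
      obtain ⟨hm, hd⟩ := mem_monics.1 hg
      refine ⟨(g.coeff 0, g.coeff 1), mem_univ _, ?_⟩
      have h2 : g.coeff 2 = 1 := by rw [← hd]; exact hm
      conv_rhs => rw [g.as_sum_range, hd]
      simp [sum_range_succ, h2, ← C_mul_X_pow_eq_monomial]
      ring
  have hval : ∀ v u : F, kloostermanChar ψ a (X ^ 2 + C u * X + C v) =
      if v = 0 then 0 else ψ (u * (-(1 + a / v))) := by
    intro v u
    have hd : (X ^ 2 + C u * X + C v : F[X]).natDegree = 2 := by compute_degree!
    rw [kloostermanChar, nextCoeff_of_natDegree_pos (by omega), hd]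
    simp only [coeff_add, coeff_X_pow, coeff_C_mul, coeff_X, coeff_C]
    norm_num
    split_ifs with hv
    · rfl
    · congr 1
      field_simp
      ring
  rw [hsum, Fintype.sum_prod_type]
  simp only [hval]
  rw [sum_eq_single (-a)]
  · simp [ha]
  · intro v _ hv
    by_cases h0 : v = 0
    · simp [h0]
    · simp only [h0, if_false]
      rw [AddChar.sum_mulShift _ hψ, if_neg, Nat.cast_zero]
      intro h
      apply hv
      field_simp at h
      linear_combination -h
  · simp

theorem monicSum_kloostermanChar_of_three_le {ψ : AddChar F ℂ} (hψ : ψ ≠ 1)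
    (a : F) {n : ℕ} (hn : 3 ≤ n) : monicSum (kloostermanChar ψ a) n = 0 := by
  obtain ⟨δ, hδ⟩ := AddChar.ne_one_iff.1 hψ
  have hshift : monicSum (kloostermanChar ψ a) n =
      ψ δ * monicSum (kloostermanChar ψ a) n := by
    conv_lhs => rw [monicSum]
    rw [monicSum, mul_sum]
    have hdeg : ∀ (c : F) (g : F[X]), g ∈ monics F n → g + C c * X ^ (n - 1) ∈ monics F n := by
      intro c g hg
      obtain ⟨hm, hd⟩ := mem_monics.1 hg
      have hlt : (C c * X ^ (n - 1) : F[X]).degree < g.degree := by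
        refine lt_of_le_of_lt (degree_C_mul_X_pow_le _ _) ?_
        rw [degree_eq_natDegree hm.ne_zero, hd]
        exact_mod_cast (by omega : n - 1 < n)
      rw [mem_monics]
      exact ⟨hm.add_of_left hlt, by rw [natDegree_add_eq_left_of_degree_lt hlt, hd]⟩
    symm
    refine sum_bij (fun g _ => g + C (-δ) * X ^ (n - 1)) (fun g hg => hdeg _ g hg) ?_ ?_ ?_
    · intro g _ g' _ h
      exact add_right_cancel h
    · intro g hg
      refine ⟨_, hdeg δ g hg, ?_⟩
      simp
    · intro g hg
      have hd := (mem_monics.1 hg).2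
      have hd' := (mem_monics.1 (hdeg (-δ) g hg)).2
      unfold kloostermanChar
      rw [nextCoeff_of_natDegree_pos (by omega), nextCoeff_of_natDegree_pos (by omega), hd, hd']
      have hc : ∀ i ≠ n - 1, (g + C (-δ) * X ^ (n - 1)).coeff i = g.coeff i := by
        intro i hi
        simp [coeff_X_pow, hi]
      rw [hc 0 (by omega), hc 1 (by omega), coeff_add, coeff_C_mul_X_pow, if_pos rfl]
      split_ifs
      · simp
      · rw [← AddChar.map_add_eq_mul]
        congr 1
        ring
  have : (1 - ψ δ) * monicSum (kloostermanChar ψ a) n = 0 := by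
    linear_combination hshift
  rcases mul_eq_zero.1 this with h | h
  · exact absurd (sub_eq_zero.1 h).symm hδ
  · exact h

/-- The sums over prime powers are the power sums of the two reciprocal roots of the
`L`-function. -/
theorem primePowerSum_kloostermanChar_eq [Fintype F] {ψ : AddChar F ℂ} (hψ : ψ.IsPrimitive)
    {a : F} (ha : a ≠ 0) {α β : ℂ} (hadd : α + β = -primePowerSum (kloostermanChar ψ a) 1)
    (hmul : α * β = Fintype.card F) (n : ℕ) :
    primePowerSum (kloostermanChar ψ a) (n + 1) = -(α ^ (n + 1) + β ^ (n + 1)) := by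
  have hψ1 : ψ ≠ 1 := by simpa using hψ one_ne_zero
  have hrec := natCast_mul_monicSum (kloostermanChar_one ψ a) (kloostermanChar_mul ψ a)
  have hA0 := monicSum_kloostermanChar_zero ψ a
  have hA2 := monicSum_kloostermanChar_two hψ ha
  have hA1 : monicSum (kloostermanChar ψ a) 1 = primePowerSum (kloostermanChar ψ a) 1 := by
    have := hrec 1
    simpa [hA0] using this
  induction n using Nat.strong_induction_on with
  | _ n ih =>
    match n, ih with
    | 0, _ =>
      rw [zero_add, pow_one, pow_one, hadd, neg_neg]
    | 1, _ =>
      have h := hrec 2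
      rw [show Icc 1 2 = {1, 2} by rfl, sum_pair (by norm_num)] at h
      simp only [Nat.add_one_sub_one, Nat.sub_self, hA0, hA1, hA2, Nat.cast_ofNat, mul_one] at h
      linear_combination -h - 2 * hmul + (α + β - primePowerSum (kloostermanChar ψ a) 1) * hadd
    | n + 2, ih =>
      have h := hrec (n + 3)
      rw [monicSum_kloostermanChar_of_three_le hψ1 a (by omega), mul_zero,
        sum_Icc_succ_top (by omega), sum_Icc_succ_top (by omega), sum_Icc_succ_top (by omega),
        sum_eq_zero] at h
      · rw [show n + 2 + 1 - (n + 2 + 1) = 0 by omega, show n + 2 + 1 - (n + 1 + 1) = 1 by omega,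
          show n + 2 + 1 - (n + 1) = 2 by omega, hA0, hA1, hA2, ih (n + 1) (by omega),
          ih n (by omega)] at h
        rw [← hmul] at h
        rw [show primePowerSum (kloostermanChar ψ a) 1 = -(α + β) by rw [hadd, neg_neg]] at h
        linear_combination -h
      · intro j hj
        rw [mem_Icc] at hj
        rw [monicSum_kloostermanChar_of_three_le hψ1 a (by omega), mul_zero]

end KloostermanLFunction

section Stepanov

open Polynomial

theorem exists_sum_C_mul_eq_zero {F ι : Type} [Field F] [Fintype ι] (p : ι → F[X]) {D : ℕ}
    (hp : ∀ i, (p i).natDegree < D) (hD : D < Fintype.card ι) :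
    ∃ c : ι → F, c ≠ 0 ∧ ∑ i, C (c i) * p i = 0 := by
  let M : Matrix (Fin D) ι F := fun n i => (p i).coeff n
  have hker : LinearMap.ker M.mulVecLin ≠ ⊥ :=
    LinearMap.ker_ne_bot_of_finrank_lt (by simpa using hD)
  obtain ⟨c, hc, hc0⟩ := Submodule.exists_mem_ne_zero_of_ne_bot hker
  refine ⟨c, hc0, ?_⟩
  ext n
  rw [finsetSum_coeff, coeff_zero]
  simp only [coeff_C_mul]
  by_cases hn : n < D
  · have := congrFun (LinearMap.mem_ker.1 hc) ⟨n, hn⟩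
    refine Eq.trans (sum_congr rfl fun i _ => mul_comm _ _) this
  · refine sum_eq_zero fun i _ => ?_
    rw [coeff_eq_zero_of_natDegree_lt (lt_of_lt_of_le (hp i) (not_lt.1 hn)), mul_zero]

theorem sum_C_mul_ne_zero_of_injective_natDegree {F ι : Type} [Field F] [Fintype ι]
    {p : ι → F[X]} (hp : ∀ i, p i ≠ 0) (hinj : Function.Injective fun i => (p i).natDegree)
    {c : ι → F} (hc : c ≠ 0) : ∑ i, C (c i) * p i ≠ 0 := by
  have hdeg := degree_sum_eq_of_disjoint (fun i => C (c i) * p i) univ (by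
    intro i hi j hj hij
    have hci : c i ≠ 0 := fun h => hi.2 (by simp [h])
    have hcj : c j ≠ 0 := fun h => hj.2 (by simp [h])
    simp only [Function.onFun, Function.comp, degree_C_mul hci, degree_C_mul hcj,
      degree_eq_natDegree (hp _)]
    exact fun h => hij (hinj (by exact_mod_cast h)))
  obtain ⟨i, hi⟩ := Function.ne_iff.1 hc
  intro h0
  rw [h0, degree_zero] at hdeg
  have := (Finset.sup_eq_bot_iff _ _).1 hdeg.symm i (mem_univ i)
  rw [degree_eq_bot] at this
  exact mul_ne_zero (C_ne_zero.2 hi) (hp i) this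

variable {F : Type} [Field F]

/-- The numerator, with denominator `X ^ q ^ (m - 1)`, of the truncated trace
`∑ i < m, f ^ q ^ i` of `f = X + a / X`. -/
noncomputable def truncatedTrace (q m : ℕ) (a : F) : F[X] :=
  ∑ i ∈ range m, (X ^ (q ^ (m - 1) + q ^ i) + C a * X ^ (q ^ (m - 1) - q ^ i))

theorem natDegree_truncatedTrace_le {q m : ℕ} (hq : 1 < q) (a : F) :
    (truncatedTrace q m a).natDegree ≤ 2 * q ^ (m - 1) := by
  refine natDegree_sum_le_of_forall_le _ _ fun i hi => ?_
  have : q ^ i ≤ q ^ (m - 1) :=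
    Nat.pow_le_pow_right (by omega) (by rw [mem_range] at hi; omega)
  refine natDegree_add_le_of_degree_le ?_ ?_
  · rw [natDegree_X_pow]
    omega
  · refine (natDegree_C_mul_X_pow_le _ _).trans ?_
    omega

theorem coeff_truncatedTrace {q m : ℕ} (hq : 1 < q) (hm : 0 < m) (a : F) :
    (truncatedTrace q m a).coeff (2 * q ^ (m - 1)) = 1 := by
  have hpos : ∀ i, 0 < q ^ i := fun i => Nat.pow_pos (by omega)
  rw [truncatedTrace, finsetSum_coeff, sum_eq_single (m - 1)]
  · have := hpos (m - 1)
    rw [coeff_add, coeff_X_pow, coeff_C_mul_X_pow, if_pos (by ring), if_neg (by omega), add_zero]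
  · intro i hi him
    have h1 := hpos i
    have h2 : q ^ i < q ^ (m - 1) :=
      Nat.pow_lt_pow_right hq (by rw [mem_range] at hi; omega)
    rw [coeff_add, coeff_X_pow, coeff_C_mul_X_pow, if_neg (by omega), if_neg (by omega), add_zero]
  · intro h
    exact absurd (mem_range.2 (by omega)) h

theorem monic_truncatedTrace {q m : ℕ} (hq : 1 < q) (hm : 0 < m) (a : F) :
    (truncatedTrace q m a).Monic :=
  monic_of_natDegree_le_of_coeff_eq_one _ (natDegree_truncatedTrace_le hq a)
    (coeff_truncatedTrace hq hm a)

theorem natDegree_truncatedTrace {q m : ℕ} (hq : 1 < q) (hm : 0 < m) (a : F) :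
    (truncatedTrace q m a).natDegree = 2 * q ^ (m - 1) :=
  le_antisymm (natDegree_truncatedTrace_le hq a)
    (le_natDegree_of_ne_zero (by rw [coeff_truncatedTrace hq hm a]; exact one_ne_zero))

variable [Fintype F]

/-- Stepanov's method: the trace of `x + a / x` takes each value about equally often. -/
theorem card_trace_eq_le {L : Type} [Field L] [Fintype L] [Algebra F L] [DecidableEq L]
    [DecidableEq F] {m : ℕ} (hm : 0 < m)
    (hL : Module.finrank F L = 2 * m) (a b : F) :
    #{x : L | x ≠ 0 ∧ Algebra.trace F L (x + algebraMap F L a * x⁻¹) = b} ≤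
      Fintype.card F ^ (2 * m - 1) + 5 * Fintype.card F ^ m := by
  set q := Fintype.card F with hq
  have hq1 : 1 < q := Fintype.one_lt_card
  set s := q ^ (m - 1) with hs
  have hspos : 0 < s := Nat.pow_pos (by omega)
  have hr : q ^ m = q * s := by
    rw [hs, ← pow_succ']
    congr 1
    omega
  have hQ : q ^ (2 * m - 1) = q * s * s := by
    rw [hs, ← pow_succ', ← pow_add]
    congr 1
    omega
  set r := q * s with hrdef
  let φ : L →ₐ[F] L := FiniteField.frobeniusAlgHom F L ^ m
  have hφ : ∀ x, φ x = x ^ r := by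
    intro x
    simp only [φ, AlgHom.coe_pow, FiniteField.coe_frobeniusAlgHom, pow_iterate]
    rw [← hr]
  have hcardL : Fintype.card L = r * r := by
    rw [← hr, ← pow_add, ← two_mul, ← hL, hq, ← Nat.card_eq_fintype_card,
      ← Nat.card_eq_fintype_card, Module.natCard_eq_pow_finrank (K := F) (V := L)]
  have hφφ : ∀ x, φ (x ^ r) = x := by
    intro x
    rw [hφ, ← pow_mul, ← hcardL, FiniteField.pow_card]
  set g := truncatedTrace q m a with hg
  have hgm : g.Monic := monic_truncatedTrace hq1 hm a
  have hgd : g.natDegree = 2 * s := natDegree_truncatedTrace hq1 hm a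
  let ι := Fin s × Fin (s + 4) × Fin q
  let R : ι → F[X] := fun z =>
    X ^ (z.1 * r + z.2.1 + (q - 1 - z.2.2) * s) * (C b * X ^ s - g) ^ (z.2.2 : ℕ)
  let G : ι → F[X] := fun z => X ^ (z.1 + r * z.2.1 + (q - 1 - z.2.2) * s) * g ^ (z.2.2 : ℕ)
  have hRdeg : ∀ z, (R z).natDegree < s * r + r + 3 := by
    rintro ⟨⟨i, hi⟩, ⟨e, he⟩, ⟨j, hj⟩⟩
    have h1 : (C b * X ^ s - g).natDegree ≤ 2 * s := by
      have : (C b * X ^ s).natDegree ≤ 2 * s := (natDegree_C_mul_X_pow_le b s).trans (by omega)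
      exact (natDegree_sub_le _ _).trans (max_le this hgd.le)
    have h2 : (R (⟨i, hi⟩, ⟨e, he⟩, ⟨j, hj⟩)).natDegree ≤
        (i * r + e + (q - 1 - j) * s) + j * (2 * s) := by
      refine natDegree_mul_le_of_le (natDegree_X_pow _).le (natDegree_pow_le_of_le _ h1)
    refine lt_of_le_of_lt h2 ?_
    obtain ⟨k, hk⟩ : ∃ k, q = k + j + 1 := ⟨q - 1 - j, by omega⟩
    have h3 : q - 1 - j = k := by omega
    obtain ⟨i', hi'⟩ : ∃ i', s = i + i' + 1 := ⟨s - 1 - i, by omega⟩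
    rw [h3]
    have h4 : s * r = i * r + i' * r + r := by rw [hi']; ring
    have h5 : r = k * s + j * s + s := by rw [hrdef, hk]; ring
    have : 0 ≤ i' * r := Nat.zero_le _
    have : 0 ≤ k * s := Nat.zero_le _
    have : j * (2 * s) = 2 * (j * s) := by ring
    omega
  obtain ⟨c, hc0, hc⟩ := exists_sum_C_mul_eq_zero R hRdeg (by
    simp only [ι, Fintype.card_prod, Fintype.card_fin]
    have : s * ((s + 4) * q) = s * r + 4 * r := by rw [hrdef]; ring
    have : 2 ≤ r := by nlinarith
    omega)
  have hGm : ∀ z, (G z).Monic := fun z => (monic_X_pow _).mul (hgm.pow _)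
  have hGd : ∀ z : ι, (G z).natDegree = z.1 + r * z.2.1 + (q - 1 + z.2.2) * s := by
    rintro ⟨⟨i, hi⟩, ⟨e, he⟩, ⟨j, hj⟩⟩
    simp only [G]
    rw [(monic_X_pow _).natDegree_mul (hgm.pow _), natDegree_X_pow, hgm.natDegree_pow, hgd]
    obtain ⟨k, hk⟩ : ∃ k, q = k + j + 1 := ⟨q - 1 - j, by omega⟩
    rw [show q - 1 - j = k by omega, show q - 1 + j = k + 2 * j by omega]
    ring
  have hGne := sum_C_mul_ne_zero_of_injective_natDegree (fun z => (hGm z).ne_zero) (by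
    rintro ⟨⟨i, hi⟩, ⟨e, he⟩, ⟨j, hj⟩⟩ ⟨⟨i', hi'⟩, ⟨e', he'⟩, ⟨j', hj'⟩⟩ h
    simp only [hGd] at h
    have h1 : i + s * (j + q * e) = i' + s * (j' + q * e') := by
      rw [hrdef] at h
      linarith
    have h2 : i = i' := by
      have := congrArg (· % s) h1
      simpa [Nat.add_mul_mod_self_left, Nat.mod_eq_of_lt hi, Nat.mod_eq_of_lt hi'] using this
    subst h2
    have h3 : j + q * e = j' + q * e' := Nat.eq_of_mul_eq_mul_left hspos (Nat.add_left_cancel h1)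
    have h4 : j = j' := by
      have := congrArg (· % q) h3
      simpa [Nat.add_mul_mod_self_left, Nat.mod_eq_of_lt hj, Nat.mod_eq_of_lt hj'] using this
    subst h4
    have h5 : e = e' := Nat.eq_of_mul_eq_mul_left (by omega) (Nat.add_left_cancel h3)
    subst h5
    rfl) hc0
  set H := ∑ z, C (c z) * G z with hH
  have hHd : H.natDegree ≤ r * s + 5 * r := by
    refine natDegree_sum_le_of_forall_le _ _ fun z _ => (natDegree_C_mul_le _ _).trans ?_
    rw [hGd]
    obtain ⟨⟨i, hi⟩, ⟨e, he⟩, ⟨j, hj⟩⟩ := z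
    simp only
    have h1 : r * e ≤ r * (s + 3) := Nat.mul_le_mul_left _ (by omega)
    have h2 : (q - 1 + j) * s ≤ (2 * q - 2) * s := Nat.mul_le_mul_right _ (by omega)
    obtain ⟨k, hk⟩ : ∃ k, q = k + 1 := ⟨q - 1, by omega⟩
    have h3 : (2 * q - 2) * s + 2 * s = 2 * r := by
      rw [hrdef, hk, show 2 * (k + 1) - 2 = 2 * k by omega]
      ring
    have h4 : r * (s + 3) = r * s + 3 * r := by ring
    omega
  have hroot : ∀ x : L, x ≠ 0 ∧ Algebra.trace F L (x + algebraMap F L a * x⁻¹) = b →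
      aeval x H = 0 := by
    rintro x ⟨hx, htr⟩
    set f := x + algebraMap F L a * x⁻¹ with hf
    set γ := ∑ i ∈ range m, f ^ q ^ i with hγ
    have hgx : aeval x g = x ^ s * γ := by
      rw [hg, truncatedTrace, map_sum, hγ, mul_sum]
      refine sum_congr rfl fun i hi => ?_
      have hle : q ^ i ≤ s :=
        Nat.pow_le_pow_right (by omega) (by rw [mem_range] at hi; omega)
      have hfi : f ^ q ^ i = x ^ q ^ i + algebraMap F L a * (x ^ q ^ i)⁻¹ := by
        have : ∀ y : L, y ^ q ^ i = (FiniteField.frobeniusAlgHom F L ^ i) y := by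
          intro y
          simp only [AlgHom.coe_pow, FiniteField.coe_frobeniusAlgHom, pow_iterate]
          rfl
        simp only [this, hf, map_add, map_mul, map_inv₀, AlgHom.commutes]
      rw [hfi]
      simp only [map_add, map_mul, map_pow, aeval_X, aeval_C]
      rw [← hs, pow_add, pow_sub₀ _ hx hle]
      ring
    have hφγ : φ γ = algebraMap F L b - γ := by
      have h1 := FiniteField.algebraMap_trace_eq_sum_pow F L f
      rw [htr, hL, two_mul, sum_range_add, Nat.card_eq_fintype_card] at h1
      rw [h1, ← hq, add_sub_cancel_left, hγ, map_sum]
      refine sum_congr rfl fun i _ => ?_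
      rw [hφ, ← hr, ← pow_mul, ← pow_add, add_comm]
    have key : φ (aeval x H) * x ^ ((q - 1) * s) =
        x ^ (r * ((q - 1) * s)) * aeval x (∑ z, C (c z) * R z) := by
      rw [hH, map_sum, map_sum, map_sum, sum_mul, mul_sum]
      refine sum_congr rfl ?_
      rintro ⟨⟨i, hi⟩, ⟨e, he⟩, ⟨j, hj⟩⟩ -
      obtain ⟨k, hk⟩ : ∃ k, q = k + j + 1 := ⟨q - 1 - j, by omega⟩
      have hGx : aeval x (G (⟨i, hi⟩, ⟨e, he⟩, ⟨j, hj⟩)) =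
          x ^ i * (x ^ r) ^ e * x ^ ((q - 1) * s) * γ ^ j := by
        simp only [G, map_mul, map_pow, aeval_X, hgx]
        rw [show q - 1 - j = k by omega, show q - 1 = k + j by omega]
        ring
      have hRx : aeval x (R (⟨i, hi⟩, ⟨e, he⟩, ⟨j, hj⟩)) =
          (x ^ r) ^ i * x ^ e * x ^ ((q - 1) * s) * (algebraMap F L b - γ) ^ j := by
        simp only [R, map_mul, map_pow, map_sub, aeval_X, aeval_C, hgx]
        rw [mul_comm _ (x ^ s), ← mul_sub, mul_pow, show q - 1 - j = k by omega, show q - 1 = k + j by omega]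
        ring
      rw [map_mul (aeval x), hGx, map_mul (aeval x), hRx, aeval_C]
      simp only [map_mul, map_pow φ _ e, hφφ]
      rw [AlgHom.commutes, map_pow φ x, map_pow φ x, map_pow φ γ, hφγ, hφ]
      ring
    rw [hc, map_zero, mul_zero] at key
    exact (map_eq_zero φ).1 ((mul_eq_zero.1 key).resolve_right (pow_ne_zero _ hx))
  have hsub : ({x : L | x ≠ 0 ∧ Algebra.trace F L (x + algebraMap F L a * x⁻¹) = b} : Finset L) ⊆
      (H.aroots L).toFinset := by
    intro x hx
    rw [mem_filter] at hx
    rw [Multiset.mem_toFinset, mem_aroots]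
    exact ⟨hGne, hroot x hx.2⟩
  calc _ ≤ #(H.aroots L).toFinset := card_le_card hsub
    _ ≤ Multiset.card (H.aroots L) := Multiset.toFinset_card_le _
    _ ≤ (H.map (algebraMap F L)).natDegree := card_roots' _
    _ = H.natDegree := natDegree_map _
    _ ≤ _ := by rw [hQ, hr]; exact hHd

end Stepanov

section KloostermanBound

open Polynomial

variable {F : Type} [Field F] [Fintype F]

theorem norm_kloostermanSum_le_of_finrank {L : Type} [Field L] [Fintype L] [Algebra F L]
    {ψ : AddChar F ℂ} (hψ : ψ ≠ 1) (a : F) {m : ℕ} (hm : 0 < m)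
    (hL : Module.finrank F L = 2 * m) :
    ‖kloostermanSum L ψ a‖ ≤ 6 * Fintype.card F * (Fintype.card F : ℝ) ^ m := by
  classical
  set q := Fintype.card F with hq
  have hq1 : (1 : ℝ) ≤ q := by exact_mod_cast (Fintype.one_lt_card (α := F)).le
  let Z : F → Finset L :=
    fun b => {x : L | x ≠ 0 ∧ Algebra.trace F L (x + algebraMap F L a * x⁻¹) = b}
  let B : ℝ := (q : ℝ) ^ (2 * m - 1) + 5 * (q : ℝ) ^ m
  have hle : ∀ b, (#(Z b) : ℝ) ≤ B := fun b => by
    simp only [B]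
    exact_mod_cast card_trace_eq_le hm hL a b
  have hfib : ∀ w : F → ℂ, (∑ x : L, if x = 0 then 0 else
      w (Algebra.trace F L (x + algebraMap F L a * x⁻¹))) = ∑ b, (#(Z b) : ℂ) * w b := by
    intro w
    rw [← sum_fiberwise univ (fun x : L => Algebra.trace F L (x + algebraMap F L a * x⁻¹))]
    refine sum_congr rfl fun b _ => ?_
    rw [← nsmul_eq_mul, ← sum_const]
    simp only [Z]
    rw [← filter_filter, filter_comm, sum_filter (fun x : L => x ≠ 0)]
    refine sum_congr rfl fun x hx => ?_
    rw [(mem_filter.1 hx).2]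
    by_cases h : x = 0 <;> simp [h]
  have htot : ∑ b, (#(Z b) : ℝ) = (q : ℝ) ^ (2 * m) - 1 := by
    have h1 := hfib fun _ => 1
    have h2 : (∑ x : L, if x = 0 then (0 : ℂ) else 1) = (q : ℂ) ^ (2 * m) - 1 := by
      have h3 : ∀ x : L, (if x = 0 then (0 : ℂ) else 1) = 1 - if x = 0 then 1 else 0 := by
        intro x
        split_ifs <;> simp
      simp only [h3]
      rw [sum_sub_distrib, sum_ite_eq' univ (0 : L), if_pos (mem_univ _), sum_const, card_univ,
        nsmul_eq_mul, mul_one, ← Nat.card_eq_fintype_card,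
        Module.natCard_eq_pow_finrank (K := F) (V := L), hL, Nat.card_eq_fintype_card]
      push_cast
      rfl
    rw [h2] at h1
    simp only [mul_one] at h1
    exact_mod_cast h1.symm
  have hsum : kloostermanSum L ψ a = -∑ b, ((B - #(Z b) : ℝ) : ℂ) * ψ b := by
    have h0 : ∑ b, ψ b = 0 := AddChar.sum_eq_zero_of_ne_one hψ
    rw [kloostermanSum, hfib]
    push_cast
    simp only [sub_mul]
    rw [sum_sub_distrib, ← mul_sum, h0]
    ring
  have hnorm : ∀ b, ‖ψ b‖ = 1 := fun b => AddChar.norm_apply ψ b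
  calc ‖kloostermanSum L ψ a‖ ≤ ∑ b, (B - #(Z b)) := by
        rw [hsum, norm_neg]
        refine (norm_sum_le _ _).trans (sum_le_sum fun b _ => ?_)
        rw [norm_mul, hnorm, mul_one, Complex.norm_real, Real.norm_of_nonneg]
        linarith [hle b]
    _ = q * B - ((q : ℝ) ^ (2 * m) - 1) := by
        rw [sum_sub_distrib, htot, sum_const, card_univ, nsmul_eq_mul]
    _ = 5 * q * (q : ℝ) ^ m + 1 := by
        have : (q : ℝ) * (q : ℝ) ^ (2 * m - 1) = (q : ℝ) ^ (2 * m) := by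
          rw [← pow_succ']
          congr 1
          omega
        simp only [B]
        rw [mul_add, this]
        ring
    _ ≤ _ := by
        have : (1 : ℝ) ≤ q * (q : ℝ) ^ m := one_le_mul_of_one_le_of_one_le hq1 (one_le_pow₀ hq1)
        nlinarith

theorem norm_le_sqrt_of_norm_pow_add_pow_le {α β : ℂ} {q C : ℝ} (hq : 0 < q)
    (hmul : ‖α‖ * ‖β‖ = q) (h : ∀ m : ℕ, 0 < m → ‖α ^ (2 * m) + β ^ (2 * m)‖ ≤ C * q ^ m) :
    ‖α‖ ≤ √q := by
  by_contra! hlt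
  have hs : √q * √q = q := Real.mul_self_sqrt hq.le
  have hsp : 0 < √q := Real.sqrt_pos.2 hq
  have hβ : ‖β‖ ≤ √q := by
    by_contra! hβ
    nlinarith
  have hρ : 1 < ‖α‖ ^ 2 / q := by
    rw [one_lt_div hq]
    nlinarith
  obtain ⟨m, hm⟩ := pow_unbounded_of_one_lt (C + 1) hρ
  have hm' : C + 1 < (‖α‖ ^ 2 / q) ^ (m + 1) :=
    lt_of_lt_of_le hm (pow_le_pow_right₀ hρ.le (by omega))
  rw [div_pow, lt_div_iff₀ (by positivity), ← pow_mul] at hm'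
  have h1 := h (m + 1) (by omega)
  have h2 : ‖β‖ ^ (2 * (m + 1)) ≤ q ^ (m + 1) := by
    rw [pow_mul]
    refine pow_le_pow_left₀ (by positivity) ?_ _
    nlinarith [norm_nonneg β]
  have h3 : ‖α‖ ^ (2 * (m + 1)) ≤
      ‖α ^ (2 * (m + 1)) + β ^ (2 * (m + 1))‖ + ‖β‖ ^ (2 * (m + 1)) := by
    rw [← norm_pow, ← norm_pow]
    simpa using norm_sub_le (α ^ (2 * (m + 1)) + β ^ (2 * (m + 1))) (β ^ (2 * (m + 1)))
  linarith

/-- Weil's bound for Kloosterman sums. -/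
theorem norm_kloostermanSum_le {ψ : AddChar F ℂ} (hψ : ψ.IsPrimitive) {a : F} (ha : a ≠ 0) :
    ‖kloostermanSum F ψ a‖ ≤ 2 * √(Fintype.card F) := by
  have hψ1 : ψ ≠ 1 := by simpa using hψ one_ne_zero
  have hq : (0 : ℝ) < Fintype.card F := by exact_mod_cast Fintype.card_pos
  obtain ⟨p, hp⟩ := CharP.exists F
  have : Fact p.Prime := ⟨CharP.char_is_prime F p⟩
  have hK : primePowerSum (kloostermanChar ψ a) 1 = kloostermanSum F ψ a := by
    rw [← primePowerSum_kloostermanChar, Module.finrank_self]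
  set K := kloostermanSum F ψ a
  obtain ⟨δ, hδ⟩ := IsAlgClosed.exists_pow_nat_eq (K ^ 2 - 4 * Fintype.card F) two_pos
  set α := (-K + δ) / 2 with hα
  set β := (-K - δ) / 2 with hβ
  have hadd : α + β = -K := by rw [hα, hβ]; ring
  have hmul : α * β = Fintype.card F := by
    rw [hα, hβ]
    linear_combination -hδ / 4
  have hnmul : ‖α‖ * ‖β‖ = Fintype.card F := by
    rw [← norm_mul, hmul, Complex.norm_natCast]
  have hpow : ∀ m : ℕ, 0 < m → ‖α ^ (2 * m) + β ^ (2 * m)‖ ≤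
      6 * Fintype.card F * (Fintype.card F : ℝ) ^ m := by
    intro m hm
    have : NeZero (2 * m) := ⟨by omega⟩
    let : Fintype (FiniteField.Extension F p (2 * m)) := Fintype.ofFinite _
    have hfin := FiniteField.finrank_extension F p (2 * m)
    have h1 := norm_kloostermanSum_le_of_finrank hψ1 a hm hfin
    have h2 := primePowerSum_kloostermanChar_eq hψ ha (by rw [hK, hadd]) hmul (2 * m - 1)
    rw [show 2 * m - 1 + 1 = 2 * m by omega] at h2
    rw [← primePowerSum_kloostermanChar, hfin, h2, norm_neg] at h1
    exact h1
  have hα' := norm_le_sqrt_of_norm_pow_add_pow_le hq hnmul hpow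
  have hβ' := norm_le_sqrt_of_norm_pow_add_pow_le hq ((mul_comm _ _).trans hnmul)
    fun m hm => by rw [add_comm]; exact hpow m hm
  rw [← norm_neg, ← hadd]
  linarith [norm_add_le α β]

end KloostermanBound

section GaussSums

variable {F : Type} [Field F] [Fintype F] [DecidableEq F]

/-- The quadratic character of a finite field with values in `ℂ`. -/
noncomputable def complexQuadraticChar (F : Type) [Field F] [Fintype F] [DecidableEq F] :
    MulChar F ℂ :=
  (quadraticChar F).ringHomComp (Int.castRingHom ℂ)

theorem complexQuadraticChar_apply (a : F) :
    complexQuadraticChar F a = (quadraticChar F a : ℂ) := rfl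

theorem complexQuadraticChar_mul_self {a : F} (ha : a ≠ 0) :
    complexQuadraticChar F a * complexQuadraticChar F a = 1 := by
  rw [complexQuadraticChar_apply, ← sq]
  exact_mod_cast quadraticChar_sq_one ha

theorem norm_complexQuadraticChar {a : F} (ha : a ≠ 0) : ‖complexQuadraticChar F a‖ = 1 := by
  rcases quadraticChar_dichotomy ha with h | h <;> simp [complexQuadraticChar_apply, h]

theorem norm_gaussSum_complexQuadraticChar (hF : ringChar F ≠ 2) {ψ : AddChar F ℂ}
    (hψ : ψ.IsPrimitive) :
    ‖gaussSum (complexQuadraticChar F) ψ‖ = √(Fintype.card F) := by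
  have h := gaussSum_sq (χ := complexQuadraticChar F)
    ((MulChar.ringHomComp_ne_one_iff (RingHom.injective_int _)).mpr (quadraticChar_ne_one hF))
    ((quadraticChar_isQuadratic F).comp _) hψ
  have h2 := congrArg norm h
  rw [norm_pow, norm_mul, norm_complexQuadraticChar (neg_ne_zero.mpr one_ne_zero), one_mul,
    Complex.norm_natCast] at h2
  rw [← h2, Real.sqrt_sq (norm_nonneg _)]

theorem card_sq_eq (hF : ringChar F ≠ 2) (a : F) :
    (#{y : F | y ^ 2 = a} : ℤ) = quadraticChar F a + 1 := by
  rw [← quadraticChar_card_sqrts hF a]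
  congr 2
  ext
  simp

theorem sum_addChar_mul_sq (hF : ringChar F ≠ 2) {ψ : AddChar F ℂ} (hψ : ψ.IsPrimitive) {w : F}
    (hw : w ≠ 0) :
    ∑ y, ψ (w * y ^ 2) = complexQuadraticChar F w * gaussSum (complexQuadraticChar F) ψ := by
  have h1 : ∑ y, ψ (w * y ^ 2) = ∑ a, (complexQuadraticChar F a + 1) * ψ (w * a) := by
    rw [← sum_fiberwise univ (fun y : F => y ^ 2)]
    refine sum_congr rfl fun a _ => ?_
    rw [sum_congr rfl (g := fun _ => ψ (w * a)) fun y hy => by rw [(mem_filter.mp hy).2],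
      sum_const, nsmul_eq_mul, complexQuadraticChar_apply]
    congr 1
    exact_mod_cast card_sq_eq hF a
  have h2 : ∑ a, ψ (w * a) = 0 := by
    simp_rw [mul_comm w]
    rw [AddChar.sum_mulShift _ hψ, if_neg hw, Nat.cast_zero]
  simp_rw [h1, add_mul, one_mul]
  rw [sum_add_distrib, h2, add_zero]
  have h3 := gaussSum_mulShift (complexQuadraticChar F) ψ (Units.mk0 w hw)
  rw [← h3, ← mul_assoc, Units.val_mk0, complexQuadraticChar_mul_self hw, one_mul]
  rfl

theorem sum_addChar_add_inv (ψ : AddChar F ℂ) {t a : F} (ht : t ≠ 0) :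
    ∑ s with s ≠ 0, ψ (t * s + a * s⁻¹) = kloostermanSum F ψ (t * a) := by
  rw [sum_filter, kloostermanSum]
  refine Fintype.sum_bijective (fun s => t * s) (mulLeft_bijective₀ t ht) _ _ fun s => ?_
  by_cases hs : s = 0
  · simp [hs]
  · rw [if_pos hs, if_neg (mul_ne_zero ht hs), Algebra.trace_self_apply]
    congr 1
    simp only [Algebra.algebraMap_self, RingHom.id_apply]
    field_simp

theorem norm_salie_le (hF : ringChar F ≠ 2) {ψ : AddChar F ℂ} (hψ : ψ.IsPrimitive) {t a : F}
    (ht : t ≠ 0) (ha : a ≠ 0) :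
    ‖∑ s with s ≠ 0, complexQuadraticChar F s * ψ (t * s + a * s⁻¹)‖
      ≤ 2 * √(Fintype.card F) := by
  set χ := complexQuadraticChar F
  set g := gaussSum χ ψ
  set q := Fintype.card F with hq
  have h2 : (2 : F) ≠ 0 := Ring.two_ne_zero hF
  have key : χ (-a) * g * ∑ s with s ≠ 0, χ s * ψ (t * s + a * s⁻¹)
      = q * ∑ y with y ^ 2 = t / a, ψ (-(2 * a) * y) := by
    have h3 : ∀ s ∈ ({s : F | s ≠ 0} : Finset F), χ (-a) * g * (χ s * ψ (t * s + a * s⁻¹))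
        = ∑ y, ψ (-(2 * a) * y) * ψ (s * (t - a * y ^ 2)) := by
      intro s hs
      have hs : s ≠ 0 := by simpa using hs
      have h4 := sum_addChar_mul_sq hF hψ (w := -a * s) (by simp [ha, hs])
      rw [map_mul] at h4
      rw [show χ (-a) * g * (χ s * ψ (t * s + a * s⁻¹)) =
        χ (-a) * χ s * g * ψ (t * s + a * s⁻¹) by ring, ← h4, sum_mul]
      symm
      refine Fintype.sum_bijective (fun y => y + s⁻¹) (Equiv.addRight s⁻¹).bijective _ _
        fun y => ?_
      rw [← AddChar.map_add_eq_mul, ← AddChar.map_add_eq_mul]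
      congr 1
      field_simp
      ring
    have h5 : ∑ y, ψ (-(2 * a) * y) = 0 := by
      simp_rw [mul_comm (-(2 * a))]
      rw [AddChar.sum_mulShift _ hψ, if_neg (by simp [h2, ha]), Nat.cast_zero]
    rw [mul_sum, sum_congr rfl h3]
    have h6 : ∑ s with s ≠ 0, ∑ y, ψ (-(2 * a) * y) * ψ (s * (t - a * y ^ 2))
        = ∑ s, ∑ y, ψ (-(2 * a) * y) * ψ (s * (t - a * y ^ 2)) := by
      rw [filter_ne', ← add_sum_erase _ _ (mem_univ 0)]
      simp only [zero_mul, AddChar.map_zero_eq_one, mul_one, h5, zero_add]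
    rw [h6, sum_comm, sum_filter, mul_sum]
    refine sum_congr rfl fun y _ => ?_
    rw [← mul_sum, AddChar.sum_mulShift _ hψ]
    have : t - a * y ^ 2 = 0 ↔ y ^ 2 = t / a := by
      rw [sub_eq_zero, eq_div_iff ha, mul_comm, eq_comm]
    by_cases hy : y ^ 2 = t / a
    · rw [if_pos (this.mpr hy), if_pos hy, mul_comm]
    · rw [if_neg (fun h => hy (this.mp h)), if_neg hy]
      simp
  have hcard : (#{y : F | y ^ 2 = t / a} : ℝ) ≤ 2 := by
    have h7 := card_sq_eq hF (t / a)
    have : #{y : F | y ^ 2 = t / a} ≤ 2 := by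
      rcases quadraticChar_dichotomy (div_ne_zero ht ha) with h | h <;> rw [h] at h7 <;> omega
    exact_mod_cast this
  have hn := congrArg norm key
  rw [norm_mul, norm_mul, norm_mul, norm_complexQuadraticChar (neg_ne_zero.mpr ha), one_mul,
    norm_gaussSum_complexQuadraticChar hF hψ, Complex.norm_natCast] at hn
  have hsum : ‖∑ y with y ^ 2 = t / a, ψ (-(2 * a) * y)‖ ≤ 2 := by
    refine (norm_sum_le _ _).trans ?_
    simpa using hcard
  have hq0 : (0 : ℝ) < q := by exact_mod_cast Fintype.card_pos
  have hsq : 0 < √(q : ℝ) := Real.sqrt_pos.mpr hq0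
  have hle : √(q : ℝ) * ‖∑ s with s ≠ 0, χ s * ψ (t * s + a * s⁻¹)‖
      ≤ √(q : ℝ) * (2 * √(q : ℝ)) := by
    rw [hn]
    nlinarith [Real.mul_self_sqrt hq0.le]
  exact le_of_mul_le_mul_left hle hsq

theorem norm_sum_complexQuadraticChar_pow_mul_le (hF : ringChar F ≠ 2) {ψ : AddChar F ℂ}
    (hψ : ψ.IsPrimitive) (d : ℕ) {t : F} (a : F) (ht : t ≠ 0) :
    ‖∑ s with s ≠ 0, complexQuadraticChar F s ^ d * ψ (t * s + a * s⁻¹)‖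
      ≤ 2 * √(Fintype.card F) := by
  have hsq : 1 ≤ √(Fintype.card F : ℝ) := by
    rw [Real.one_le_sqrt]
    exact_mod_cast Fintype.card_pos
  rcases Nat.even_or_odd' d with ⟨m, rfl | rfl⟩
  · have : ∑ s with s ≠ 0, complexQuadraticChar F s ^ (2 * m) * ψ (t * s + a * s⁻¹)
        = kloostermanSum F ψ (t * a) := by
      rw [← sum_addChar_add_inv ψ ht]
      refine sum_congr rfl fun s hs => ?_
      rw [pow_mul, sq, complexQuadraticChar_mul_self (by simpa using hs), one_pow, one_mul]
    rw [this]
    by_cases ha : a = 0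
    · have h1 : kloostermanSum F ψ (t * a) = -1 := by
        have h0 : ∑ s, ψ (s * t) = 0 := by
          rw [AddChar.sum_mulShift _ hψ, if_neg ht, Nat.cast_zero]
        rw [← add_sum_erase _ _ (mem_univ 0), zero_mul, AddChar.map_zero_eq_one] at h0
        rw [← sum_addChar_add_inv ψ ht, filter_ne', eq_neg_iff_add_eq_zero, add_comm, ← h0]
        simp [ha, mul_comm]
      rw [h1, norm_neg, norm_one]
      linarith
    · exact norm_kloostermanSum_le hψ (mul_ne_zero ht ha)
  · have : ∑ s with s ≠ 0, complexQuadraticChar F s ^ (2 * m + 1) * ψ (t * s + a * s⁻¹)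
        = ∑ s with s ≠ 0, complexQuadraticChar F s * ψ (t * s + a * s⁻¹) := by
      refine sum_congr rfl fun s hs => ?_
      rw [pow_succ, pow_mul, sq, complexQuadraticChar_mul_self (by simpa using hs), one_pow,
        one_mul]
    rw [this]
    by_cases ha : a = 0
    · have h1 : ∑ s with s ≠ 0, complexQuadraticChar F s * ψ (t * s + a * s⁻¹)
          = gaussSum (complexQuadraticChar F) (ψ.mulShift t) := by
        rw [gaussSum, filter_ne', ← add_sum_erase _ _ (mem_univ 0)]
        simp [ha, AddChar.mulShift_apply, MulChar.map_zero]
      have h2 := congrArg norm (gaussSum_mulShift (complexQuadraticChar F) ψ (Units.mk0 t ht))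
      rw [norm_mul, Units.val_mk0, norm_complexQuadraticChar ht, one_mul,
        norm_gaussSum_complexQuadraticChar hF hψ] at h2
      rw [h1, h2]
      linarith
    · exact norm_salie_le hF hψ ht ha

end GaussSums

section SphereFourier

theorem sum_addChar_linear {F V : Type} [Field F] [AddCommGroup V] [Module F V] [Fintype V]
    {ψ : AddChar F ℂ} (hψ : ψ.IsPrimitive) {l : V →ₗ[F] F} (hl : l ≠ 0) :
    ∑ x, ψ (l x) = 0 := by
  refine AddChar.sum_eq_zero_of_ne_one (ψ := ψ.compAddMonoidHom l.toAddMonoidHom) fun h => ?_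
  refine hψ (one_ne_zero) ?_
  ext b
  obtain ⟨x, rfl⟩ := LinearMap.surjective hl b
  simpa using DFunLike.congr_fun h x

theorem AddChar.map_sum_eq_prod {A ι : Type} [AddCommMonoid A] (ψ : AddChar A ℂ) (s : Finset ι)
    (f : ι → A) : ψ (∑ i ∈ s, f i) = ∏ i ∈ s, ψ (f i) := by
  classical
  induction s using Finset.induction_on with
  | empty => simp
  | insert i s hi ih => rw [sum_insert hi, prod_insert hi, AddChar.map_add_eq_mul, ih]

variable {F : Type} [Field F] [Fintype F] {d : ℕ} {Q : QuadraticForm F (Fin d → F)}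

theorem sum_addChar_polar_left (hQ : (QuadraticMap.polarBilin Q).Nondegenerate)
    {ψ : AddChar F ℂ} (hψ : ψ.IsPrimitive) {v : Fin d → F} (hv : v ≠ 0) :
    ∑ z, ψ (QuadraticMap.polar Q z v) = 0 := by
  refine sum_addChar_linear (l := (QuadraticMap.polarBilin Q).flip v) hψ fun h => hv ?_
  exact hQ.2 v fun z => DFunLike.congr_fun h z

variable [DecidableEq F]

theorem exists_sum_addChar_quadraticForm (hF : ringChar F ≠ 2) {ψ : AddChar F ℂ}
    (hψ : ψ.IsPrimitive) (hQ : (QuadraticMap.polarBilin Q).Nondegenerate) :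
    ∃ c : ℂ, ‖c‖ = √(Fintype.card F) ^ d ∧
      ∀ s, s ≠ 0 → ∑ x, ψ (s * Q x) = complexQuadraticChar F s ^ d * c := by
  have h2 : (2 : F) ≠ 0 := Ring.two_ne_zero hF
  let _ : Invertible (2 : F) := invertibleOfNonzero h2
  have hsep : (QuadraticMap.associated (R := F) Q).SeparatingLeft := by
    intro x hx
    refine hQ.1 x fun y => ?_
    have := DFunLike.congr_fun (DFunLike.congr_fun (QuadraticMap.two_nsmul_associated F Q) x) y
    rw [← this, LinearMap.smul_apply, LinearMap.smul_apply, hx y, smul_zero]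
  obtain ⟨w, ⟨e⟩⟩ := Q.equivalent_weightedSumSquares_units_of_nondegenerate' hsep
  have hn : Module.finrank F (Fin d → F) = d := Module.finrank_fin_fun F
  refine ⟨∏ i, (complexQuadraticChar F (w i) * gaussSum (complexQuadraticChar F) ψ), ?_, ?_⟩
  · have h : ∀ i, ‖complexQuadraticChar F (w i)‖ = 1 := fun i =>
      norm_complexQuadraticChar (w i).ne_zero
    simp [norm_prod, h, norm_gaussSum_complexQuadraticChar hF hψ, hn]
  · intro s hs
    calc ∑ x, ψ (s * Q x) =
        ∑ y : Fin (Module.finrank F (Fin d → F)) → F, ∏ i, ψ (s * w i * y i ^ 2) := by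
          refine Fintype.sum_equiv e.toLinearEquiv.toEquiv _ _ fun x => ?_
          rw [← AddChar.map_sum_eq_prod]
          congr 1
          have := e.map_app x
          rw [← this, QuadraticMap.weightedSumSquares_apply, mul_sum]
          refine sum_congr rfl fun i _ => ?_
          rw [Units.smul_def, smul_eq_mul, sq, ← mul_assoc]
          rfl
      _ = ∏ i, ∑ y, ψ (s * w i * y ^ 2) :=
          (Fintype.prod_sum fun i y => ψ (s * w i * y ^ 2)).symm
      _ = _ := by
          rw [prod_congr rfl fun i _ => sum_addChar_mul_sq hF hψ (mul_ne_zero hs (w i).ne_zero)]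
          simp_rw [map_mul, mul_assoc]
          rw [prod_mul_distrib]
          simp [hn]

/-- The Fourier transform of the level set `Q = t ≠ 0` away from the origin. -/
theorem card_mul_norm_sum_level_le (hF : ringChar F ≠ 2) {ψ : AddChar F ℂ}
    (hψ : ψ.IsPrimitive) (hQ : (QuadraticMap.polarBilin Q).Nondegenerate) {t : F} (ht : t ≠ 0)
    {v : Fin d → F} (hv : v ≠ 0) :
    Fintype.card F * ‖∑ z with Q z = t, ψ (QuadraticMap.polar Q z v)‖
      ≤ 2 * √(Fintype.card F) ^ (d + 1) := by
  obtain ⟨c, hc, hsum⟩ := exists_sum_addChar_quadraticForm hF hψ hQ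
  have key : Fintype.card F * ∑ z with Q z = t, ψ (QuadraticMap.polar Q z v)
      = (∑ s with s ≠ 0, complexQuadraticChar F s ^ d * ψ (-t * s + -Q v * s⁻¹)) * c := by
    calc Fintype.card F * ∑ z with Q z = t, ψ (QuadraticMap.polar Q z v)
        = ∑ z, ∑ s, ψ (s * (Q z - t)) * ψ (QuadraticMap.polar Q z v) := by
          rw [sum_filter, mul_sum]
          refine sum_congr rfl fun z _ => ?_
          rw [← sum_mul, AddChar.sum_mulShift _ hψ]
          by_cases h : Q z = t <;> simp [h, sub_eq_zero]
      _ = ∑ s with s ≠ 0, ∑ z, ψ (s * (Q z - t)) * ψ (QuadraticMap.polar Q z v) := by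
          rw [sum_comm, filter_ne', ← add_sum_erase _ _ (mem_univ 0)]
          simp [sum_addChar_polar_left hQ hψ hv]
      _ = _ := by
          rw [sum_mul]
          refine sum_congr rfl fun s hs => ?_
          have hs : s ≠ 0 := by simpa using hs
          rw [mul_right_comm, ← hsum s hs, sum_mul]
          refine Fintype.sum_bijective (fun z => z + s⁻¹ • v) (Equiv.addRight _).bijective _ _
            fun z => ?_
          rw [← AddChar.map_add_eq_mul, ← AddChar.map_add_eq_mul]
          congr 1
          rw [QuadraticMap.map_add Q, QuadraticMap.map_smul, QuadraticMap.polar_smul_right]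
          simp only [smul_eq_mul]
          field_simp
          ring
  have hn := congrArg norm key
  rw [norm_mul, norm_mul, Complex.norm_natCast, hc] at hn
  rw [hn, pow_succ', ← mul_assoc]
  exact mul_le_mul_of_nonneg_right
    (norm_sum_complexQuadraticChar_pow_mul_le hF hψ d (-Q v) (neg_ne_zero.mpr ht)) (by positivity)

end SphereFourier

section EnergyFourier

variable {F : Type} [Field F] [Fintype F] {d : ℕ} {Q : QuadraticForm F (Fin d → F)}

/-- The Fourier transform of the indicator function of `E` with respect to the pairing
`ψ (polar Q x v)`. -/
noncomputable def polarFourier (ψ : AddChar F ℂ) (Q : QuadraticForm F (Fin d → F))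
    (E : Finset (Fin d → F)) (v : Fin d → F) : ℂ :=
  ∑ x ∈ E, ψ (QuadraticMap.polar Q x v)

theorem polar_sum_left {F ι : Type} [Field F] {d : ℕ} {Q : QuadraticForm F (Fin d → F)} (s : Finset ι) (x : ι → Fin d → F) (v : Fin d → F) :
    QuadraticMap.polar Q (∑ i ∈ s, x i) v = ∑ i ∈ s, QuadraticMap.polar Q (x i) v := by
  change QuadraticMap.polarBilin Q _ v = ∑ i ∈ s, QuadraticMap.polarBilin Q (x i) v
  rw [map_sum, LinearMap.sum_apply]

theorem sum_addChar_polar_right (hQ : (QuadraticMap.polarBilin Q).Nondegenerate)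
    {ψ : AddChar F ℂ} (hψ : ψ.IsPrimitive) (y : Fin d → F) [Decidable (y = 0)] :
    ∑ v, ψ (QuadraticMap.polar Q y v) = if y = 0 then (Fintype.card F : ℂ) ^ d else 0 := by
  split_ifs with hy
  · simp [hy]
  · simp_rw [QuadraticMap.polar_comm _ y]
    exact sum_addChar_polar_left hQ hψ hy

theorem card_pow_mul_nuQ [DecidableEq F] (hQ : (QuadraticMap.polarBilin Q).Nondegenerate)
    {ψ : AddChar F ℂ} (hψ : ψ.IsPrimitive) (E : Finset (Fin d → F)) (k : ℕ) (t : F) :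
    (Fintype.card F : ℂ) ^ d * nuQ Q E k t =
      ∑ v, (∑ z with Q z = t, ψ (QuadraticMap.polar Q z (-v))) * polarFourier ψ Q E v ^ k := by
  have hnu : nuQ Q E k t = #{x ∈ Fintype.piFinset fun _ : Fin k => E | Q (∑ i, x i) = t} := by
    rw [nuQ, Nat.card_eq_fintype_card, Fintype.card_subtype]
    congr 1
    ext x
    simp
  have hpow : ∀ v, polarFourier ψ Q E v ^ k =
      ∑ x ∈ Fintype.piFinset fun _ : Fin k => E, ψ (QuadraticMap.polar Q (∑ i, x i) v) := by
    intro v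
    simp_rw [polar_sum_left, AddChar.map_sum_eq_prod]
    rw [sum_prod_piFinset E fun (_ : Fin k) y => ψ (QuadraticMap.polar Q y v)]
    simp [polarFourier]
  have hterm : ∀ y : Fin d → F, ∑ z with Q z = t, ∑ v,
      ψ (QuadraticMap.polar Q z (-v)) * ψ (QuadraticMap.polar Q y v)
        = if Q y = t then (Fintype.card F : ℂ) ^ d else 0 := by
    intro y
    have h1 : ∀ z, ∑ v, ψ (QuadraticMap.polar Q z (-v)) * ψ (QuadraticMap.polar Q y v)
        = if y = z then (Fintype.card F : ℂ) ^ d else 0 := by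
      intro z
      simp_rw [← AddChar.map_add_eq_mul, QuadraticMap.polar_neg_right, neg_add_eq_sub,
        ← QuadraticMap.polar_sub_left, sum_addChar_polar_right hQ hψ, sub_eq_zero]
    simp_rw [h1, sum_ite_eq, mem_filter_univ]
  rw [hnu, card_filter]
  push_cast
  rw [mul_sum]
  simp_rw [hpow, mul_sum, sum_mul]
  rw [sum_comm]
  refine sum_congr rfl fun x _ => ?_
  rw [sum_comm, hterm]
  simp

theorem card_pow_mul_energy (hQ : (QuadraticMap.polarBilin Q).Nondegenerate)
    {ψ : AddChar F ℂ} (hψ : ψ.IsPrimitive) (E : Finset (Fin d → F)) (m : ℕ) :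
    (Fintype.card F : ℝ) ^ d * energy E (2 * m) = ∑ v, ‖polarFourier ψ Q E v‖ ^ (2 * m) := by
  classical
  let y : (Fin (2 * m) → Fin d → F) → Fin d → F := fun x =>
    ∑ i : Fin (2 * m), if (i : ℕ) < m then x i else -x i
  have hen : energy E (2 * m) = #{x ∈ Fintype.piFinset fun _ : Fin (2 * m) => E | y x = 0} := by
    rw [energy, Nat.card_eq_fintype_card, Fintype.card_subtype]
    congr 1
    ext x
    simp only [y, mem_filter, mem_univ, true_and, Fintype.mem_piFinset, sum_ite,
      sum_neg_distrib, ← sub_eq_add_neg, sub_eq_zero, Nat.mul_div_cancel_left m two_pos]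
  have hpow : ∀ v, ((‖polarFourier ψ Q E v‖ ^ (2 * m) : ℝ) : ℂ) =
      ∑ x ∈ Fintype.piFinset fun _ : Fin (2 * m) => E, ψ (QuadraticMap.polar Q (y x) v) := by
    intro v
    have hconj : ∑ x ∈ E, ψ (QuadraticMap.polar Q (-x) v)
        = (starRingEnd ℂ) (polarFourier ψ Q E v) := by
      simp [polarFourier, map_sum, QuadraticMap.polar_neg_left, AddChar.map_neg_eq_conj]
    have hcard : #{i : Fin (2 * m) | (i : ℕ) < m} = m := by
      rw [Fin.card_filter_val_lt]
      omega
    have hcard' : #{i : Fin (2 * m) | ¬ (i : ℕ) < m} = m := by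
      have := card_filter_add_card_filter_not (s := (univ : Finset (Fin (2 * m))))
        (fun i => (i : ℕ) < m)
      rw [card_univ, Fintype.card_fin] at this
      omega
    simp_rw [y, polar_sum_left, AddChar.map_sum_eq_prod]
    rw [sum_prod_piFinset E fun (i : Fin (2 * m)) z =>
      ψ (QuadraticMap.polar Q (if (i : ℕ) < m then z else -z) v)]
    have hfac : ∀ i : Fin (2 * m),
        ∑ z ∈ E, ψ (QuadraticMap.polar Q (if (i : ℕ) < m then z else -z) v) =
          if (i : ℕ) < m then polarFourier ψ Q E v
            else (starRingEnd ℂ) (polarFourier ψ Q E v) := by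
      intro i
      split_ifs
      · rfl
      · exact hconj
    simp_rw [hfac]
    rw [prod_ite, prod_const, prod_const, hcard, hcard', ← mul_pow, Complex.mul_conj, pow_mul,
      ← Complex.normSq_eq_norm_sq]
    push_cast
    rfl
  apply Complex.ofReal_injective
  rw [Complex.ofReal_sum, sum_congr rfl fun v _ => hpow v, sum_comm,
    sum_congr rfl fun x _ => sum_addChar_polar_right hQ hψ (y x), hen, card_filter]
  push_cast
  rw [mul_sum]
  refine sum_congr rfl fun x _ => ?_
  split_ifs <;> simp

end EnergyFourier

/-- Odd-`k` estimate for `ν_k(t)` in terms of the sphere size and the energies. -/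
theorem stmt6 (F : Type) [Field F] [Fintype F] (hq : Odd (Fintype.card F))
    (d : ℕ) (hd : 2 ≤ d) (Q : QuadraticForm F (Fin d → F))
    (hQ : LinearMap.Nondegenerate (QuadraticMap.polarBilin Q))
    (E : Finset (Fin d → F)) (k : ℕ) (hk : 3 ≤ k) (hko : Odd k) (t : F) (ht : t ≠ 0) :
    |(nuQ Q E k t : ℝ) -
        (Nat.card {x : Fin d → F | Q x = t} : ℝ) * (E.card : ℝ) ^ k / (Fintype.card F : ℝ) ^ d| ≤
      2 * (Fintype.card F : ℝ) ^ (((d : ℝ) - 1) / 2) *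
        Real.sqrt (energy E (k - 1)) * Real.sqrt (energy E (k + 1)) := by
  classical
  set q := Fintype.card F with hqdef
  have hq0 : (0 : ℝ) < q := by exact_mod_cast Fintype.card_pos
  have hF : ringChar F ≠ 2 := fun h =>
    Nat.not_even_iff_odd.mpr hq (Nat.even_iff.mpr (FiniteField.even_card_iff_char_two.mp h))
  set ψ := AddChar.FiniteField.primitiveChar_to_Complex F
  have hψ : ψ.IsPrimitive := AddChar.FiniteField.primitiveChar_to_Complex_isPrimitive F
  obtain ⟨l, rfl⟩ := hko
  set f := fun v => ‖polarFourier ψ Q E v‖ with hf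
  set C : ℝ := (q : ℝ) ^ (((d : ℝ) - 1) / 2) with hC
  have hCq : √(q : ℝ) ^ (d + 1) = q * C := by
    rw [hC, Real.sqrt_eq_rpow, ← Real.rpow_natCast, ← Real.rpow_mul hq0.le]
    nth_rw 2 [← Real.rpow_one (q : ℝ)]
    rw [← Real.rpow_add hq0]
    congr 1
    push_cast
    ring
  have hσ : ∀ v : Fin d → F, v ≠ 0 →
      ‖∑ z with Q z = t, ψ (QuadraticMap.polar Q z (-v))‖ ≤ 2 * C := by
    intro v hv
    have h := card_mul_norm_sum_level_le hF hψ hQ ht (neg_ne_zero.mpr hv)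
    rw [← hqdef, hCq, mul_left_comm] at h
    exact le_of_mul_le_mul_left h hq0
  have hzero : (∑ z with Q z = t, ψ (QuadraticMap.polar Q z (-0))) *
      polarFourier ψ Q E 0 ^ (2 * l + 1)
        = (Nat.card {x : Fin d → F | Q x = t} : ℂ) * (#E : ℂ) ^ (2 * l + 1) := by
    simp [polarFourier, Fintype.card_subtype]
  have hmain := card_pow_mul_nuQ hQ hψ E (2 * l + 1) t
  rw [← add_sum_erase _ _ (mem_univ 0), hzero, ← sub_eq_iff_eq_add'] at hmain
  have hnorm : |(q : ℝ) ^ d * nuQ Q E (2 * l + 1) t -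
      (Nat.card {x : Fin d → F | Q x = t} : ℝ) * (#E : ℝ) ^ (2 * l + 1)| ≤
        2 * C * ∑ v, f v ^ (2 * l + 1) := by
    rw [← Real.norm_eq_abs, ← Complex.norm_real]
    push_cast
    rw [hmain]
    calc _ ≤ ∑ v ∈ univ.erase 0, 2 * C * f v ^ (2 * l + 1) := by
          refine norm_sum_le_of_le _ fun v hv => ?_
          rw [norm_mul, norm_pow]
          exact mul_le_mul_of_nonneg_right (hσ v (ne_of_mem_erase hv)) (by positivity)
      _ ≤ ∑ v, 2 * C * f v ^ (2 * l + 1) :=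
          sum_le_sum_of_subset_of_nonneg (erase_subset _ _) fun v _ _ => by positivity
      _ = _ := (mul_sum _ _ _).symm
  have hCS : ∑ v, f v ^ (2 * l + 1) ≤
      (q : ℝ) ^ d * (√(energy E (2 * l)) * √(energy E (2 * l + 1 + 1))) := by
    calc ∑ v, f v ^ (2 * l + 1) = ∑ v, f v ^ l * f v ^ (l + 1) := by
          refine sum_congr rfl fun v _ => ?_
          rw [← pow_add]
          congr 1
          ring
      _ ≤ √(∑ v, (f v ^ l) ^ 2) * √(∑ v, (f v ^ (l + 1)) ^ 2) :=
          Real.sum_mul_le_sqrt_mul_sqrt _ _ _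
      _ = √((q : ℝ) ^ d * energy E (2 * l)) * √((q : ℝ) ^ d * energy E (2 * (l + 1))) := by
          rw [card_pow_mul_energy hQ hψ, card_pow_mul_energy hQ hψ]
          simp_rw [← pow_mul', hf]
      _ = _ := by
          rw [Real.sqrt_mul (by positivity), Real.sqrt_mul (by positivity), mul_mul_mul_comm,
            Real.mul_self_sqrt (by positivity)]
          rfl
  have hqd : (0 : ℝ) < (q : ℝ) ^ d := by positivity
  have hC0 : 0 ≤ C := by positivity
  rw [Nat.add_sub_cancel]
  refine le_of_mul_le_mul_left ?_ hqd
  calc _ = |(q : ℝ) ^ d * nuQ Q E (2 * l + 1) t -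
      (Nat.card {x : Fin d → F | Q x = t} : ℝ) * (#E : ℝ) ^ (2 * l + 1)| := by
        nth_rw 1 [← abs_of_pos hqd]
        rw [← abs_mul, mul_sub, mul_div_cancel₀ _ hqd.ne']
    _ ≤ 2 * C * ((q : ℝ) ^ d * (√(energy E (2 * l)) * √(energy E (2 * l + 1 + 1)))) :=
        hnorm.trans (mul_le_mul_of_nonneg_left hCS (by positivity))
    _ = _ := by ring
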